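/- arXiv:2605.30713 — 2 statements merged into one kernel-verified Lean document; each statement's English description precedes it below -/
import Mathlib

section
/- Let K ≥ 2 and let π be a probability mass function on Fin K with π(i) > 0 for every i. For λ ∈ [0,1], let P_λ(i,j) = λ·π(i)·(if i = j then 1 else 0) + (1−λ)·π(i)·π(j), and define the mutual information I(λ) = ∑_{i,j} P_λ(i,j) · log( P_λ(i,j) / (π(i)·π(j)) ), with the convention 0·log 0 = 0. Then I is monotone nondecreasing on [0,1]: for all 0 ≤ λ₁ ≤ λ₂ ≤ 1, I(λ₁) ≤ I(λ₂). -/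
/-- Along the segment from `1` to `x`, the gain of `x * log x` is at least that of its tangent line
at `1`. -/
theorem mul_log_segment_le {x t : ℝ} (hx : 0 ≤ x) (ht0 : 0 ≤ t) (ht1 : t ≤ 1) :
    (t * x + (1 - t)) * Real.log (t * x + (1 - t)) ≤
      x * Real.log x - (1 - t) * (x - 1) := by
  have hconv := Real.convexOn_mul_log.2 (Set.mem_Ici.2 hx) (Set.mem_Ici.2 zero_le_one)
    ht0 (sub_nonneg.2 ht1) (by ring)
  simp only [smul_eq_mul, mul_one, Real.log_one, mul_zero, add_zero] at hconv
  have htangent : x - 1 ≤ x * Real.log x := by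
    rcases hx.eq_or_lt with rfl | hpos
    · norm_num
    · have h := mul_le_mul_of_nonneg_left (Real.one_sub_inv_le_log_of_pos hpos) hx
      rwa [mul_sub, mul_one, mul_inv_cancel₀ hpos.ne'] at h
  nlinarith [mul_le_mul_of_nonneg_left htangent (sub_nonneg.2 ht1)]

/-- The form of `mul_log_segment_le` relative to a positive weight `q`. -/
theorem mul_log_div_segment_le {p q t : ℝ} (hp : 0 ≤ p) (hq : 0 < q) (ht0 : 0 ≤ t)
    (ht1 : t ≤ 1) :
    (t * p + (1 - t) * q) * Real.log ((t * p + (1 - t) * q) / q) ≤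
      p * Real.log (p / q) - (1 - t) * (p - q) := by
  have h := mul_le_mul_of_nonneg_left (mul_log_segment_le (div_nonneg hp hq.le) ht0 ht1) hq.le
  have hdiv : (t * p + (1 - t) * q) / q = t * (p / q) + (1 - t) := by field_simp
  have hpq : q * (p / q) = p := mul_div_cancel₀ p hq.ne'
  rw [hdiv]
  calc _ = q * ((t * (p / q) + (1 - t)) * Real.log (t * (p / q) + (1 - t))) := by
        nth_rewrite 1 [← hpq]
        ring
    _ ≤ _ := h
    _ = q * (p / q) * Real.log (p / q) - (1 - t) * (q * (p / q) - q) := by ring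
    _ = _ := by rw [hpq]


/-- For a strictly positive pmf `π` on `Fin K` (`K ≥ 2`), the mutual
information `I(λ) = ∑_{i,j} P_λ(i,j)·log(P_λ(i,j)/(π i·π j))` of the
copy-or-independent coupling `P_λ(i,j) = λ·π i·[i=j] + (1−λ)·π i·π j`
is monotone nondecreasing in `λ` on `[0,1]`.  (The convention `0·log 0 = 0`
is automatic since `Real.log 0 = 0`.) -/
theorem mutual_information_monotone_in_dependency
    (K : ℕ) (hK : 2 ≤ K) (π : Fin K → ℝ)
    (hπpos : ∀ k, 0 < π k) (hπ1 : ∑ k, π k = 1) :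
    ∀ lam₁ lam₂ : ℝ, 0 ≤ lam₁ → lam₁ ≤ lam₂ → lam₂ ≤ 1 →
      (∑ i : Fin K, ∑ j : Fin K,
          (lam₁ * π i * (if i = j then (1:ℝ) else 0) + (1 - lam₁) * π i * π j) *
            Real.log ((lam₁ * π i * (if i = j then (1:ℝ) else 0) + (1 - lam₁) * π i * π j)
              / (π i * π j)))
      ≤
      (∑ i : Fin K, ∑ j : Fin K,
          (lam₂ * π i * (if i = j then (1:ℝ) else 0) + (1 - lam₂) * π i * π j) *
            Real.log ((lam₂ * π i * (if i = j then (1:ℝ) else 0) + (1 - lam₂) * π i * π j)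
              / (π i * π j))) := by
  intro a b ha hab hb
  rcases (ha.trans hab).eq_or_lt with rfl | hbpos
  · rw [le_antisymm hab ha]
  have hsum : ∑ i : Fin K, ∑ j : Fin K,
      (1 - a / b) * ((b * π i * (if i = j then (1:ℝ) else 0) + (1 - b) * π i * π j)
        - π i * π j) = 0 := by
    refine Finset.sum_eq_zero fun i _ => ?_
    rw [← Finset.mul_sum, Finset.sum_sub_distrib, Finset.sum_add_distrib, ← Finset.mul_sum,
      ← Finset.mul_sum, ← Finset.mul_sum, hπ1]
    simp only [Finset.sum_ite_eq, Finset.mem_univ, if_true]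
    ring
  refine le_of_le_of_eq ?_ ((congrArg _ hsum).trans (sub_zero _))
  simp only [← Finset.sum_sub_distrib]
  refine Finset.sum_le_sum fun i _ => Finset.sum_le_sum fun j _ => ?_
  have hi := hπpos i
  have hj := hπpos j
  have hb' : 0 ≤ 1 - b := sub_nonneg.2 hb
  have hp : 0 ≤ b * π i * (if i = j then (1:ℝ) else 0) + (1 - b) * π i * π j := by
    split_ifs <;> positivity
  have hmix : a * π i * (if i = j then (1:ℝ) else 0) + (1 - a) * π i * π j =
      a / b * (b * π i * (if i = j then (1:ℝ) else 0) + (1 - b) * π i * π j)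
        + (1 - a / b) * (π i * π j) := by
    field_simp
    ring
  rw [hmix]
  exact mul_log_div_segment_le hp (mul_pos hi hj) (div_nonneg ha hbpos.le)
    ((div_le_one hbpos).2 hab)
end

section
/- Let K ≥ 2 and let π be a probability mass function on Fin K. Fix Y ∈ Fin K and assume Y is the unique mode of π: π(Y) > π(k) for every k ≠ Y. For each U ≥ 1, let q_U be the probability, under the U-fold product measure π^{⊗U} on (Fin K)^U, of the unique-plurality-winner event W_Y^{(U)} = { x : for every k ≠ Y, #{u : x(u) = Y} > #{u : x(u) = k} }. Then q_U → 1 as U → ∞; that is, majority voting over independent samples is asymptotically correct. -/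
/-- The likelihood ratio `s ^ (#j - #Y)` of a profile factors over its coordinates. -/
lemma prod_tilt_eq {α : Type*} [DecidableEq α] {U : ℕ} (x : Fin U → α) (j Y : α) (s : ℝ) :
    ∏ u, ((if x u = j then s else 1) * (if x u = Y then s⁻¹ else 1)) =
      s ^ (Finset.univ.filter (fun u => x u = j)).card *
        (s ^ (Finset.univ.filter (fun u => x u = Y)).card)⁻¹ := by
  rw [Finset.prod_mul_distrib]
  simp [Finset.prod_ite]

lemma one_le_prod_tilt {α : Type*} [DecidableEq α] {U : ℕ} (x : Fin U → α) (j Y : α) {s : ℝ}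
    (hs : 1 ≤ s) (h : (Finset.univ.filter (fun u => x u = Y)).card ≤
      (Finset.univ.filter (fun u => x u = j)).card) :
    1 ≤ ∏ u, ((if x u = j then s else 1) * (if x u = Y then s⁻¹ else 1)) := by
  rw [prod_tilt_eq, ← div_eq_mul_inv, one_le_div (by positivity)]
  exact pow_le_pow_right₀ hs h

/-- Exponential tilting: a suitable factor makes the moment generating function of the
margin of `j` over a strictly likelier `Y` smaller than `1`. -/
lemma exists_tilt_sum_lt_one {α : Type*} [Fintype α] [DecidableEq α] {p : α → ℝ}
    (hp0 : ∀ k, 0 ≤ p k) (hp1 : ∑ k, p k = 1) {j Y : α} (hjY : j ≠ Y) (h : p j < p Y) :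
    ∃ s : ℝ, 1 ≤ s ∧
      ∑ k, p k * ((if k = j then s else 1) * (if k = Y then s⁻¹ else 1)) < 1 := by
  have hj := hp0 j
  obtain ⟨s, hs1, hs⟩ : ∃ s : ℝ, 1 < s ∧ p j * s < p Y := by
    refine ⟨2 * p Y / (p Y + p j), ?_, ?_⟩
    · rw [lt_div_iff₀ (by linarith)]
      linarith
    · rw [← mul_div_assoc, div_lt_iff₀ (by linarith)]
      nlinarith
  refine ⟨s, hs1.le, ?_⟩
  have hexp : ∀ k, p k * ((if k = j then s else 1) * (if k = Y then s⁻¹ else 1)) =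
      p k + ((if k = j then p k * (s - 1) else 0) +
        (if k = Y then p k * (s⁻¹ - 1) else 0)) := by
    intro k
    by_cases h1 : k = j
    · subst h1
      simp only [if_true, if_neg hjY]
      ring
    · by_cases h2 : k = Y <;> simp only [h1, h2, if_true, if_false] <;> ring_nf
      all_goals simp [hjY.symm]
  simp only [hexp, Finset.sum_add_distrib, hp1, Finset.sum_ite_eq', Finset.mem_univ, if_true]
  have hs0 : s ≠ 0 := by positivity
  have hfac : p j * (s - 1) + p Y * (s⁻¹ - 1) = (s - 1) * (p j * s - p Y) / s := by
    field_simp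
    ring
  have hneg : (s - 1) * (p j * s - p Y) / s < 0 :=
    div_neg_of_neg_of_pos (mul_neg_of_pos_of_neg (by linarith) (by linarith)) (by linarith)
  linarith

/-- If `Y` is the unique mode of the pmf `π` on `Fin K` (`K ≥ 2`),
then the probability `q_U`, under the `U`-fold product measure `π^{⊗U}`, of the
event that `Y` is the unique plurality winner of the `U` i.i.d. predictions
tends to `1` as `U → ∞`. -/
theorem iid_plurality_vote_asymptotically_correct
    (K : ℕ) (hK : 2 ≤ K) (π : Fin K → ℝ)
    (hπ0 : ∀ k, 0 ≤ π k) (hπ1 : ∑ k, π k = 1)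
    (Y : Fin K) (hmode : ∀ k : Fin K, k ≠ Y → π k < π Y) :
    Filter.Tendsto
      (fun U : ℕ => ∑ x : Fin U → Fin K,
        (if (∀ j : Fin K, j ≠ Y →
              (Finset.univ.filter (fun u : Fin U => x u = j)).card
                < (Finset.univ.filter (fun u : Fin U => x u = Y)).card)
          then ∏ u : Fin U, π (x u) else 0))
      Filter.atTop (nhds 1) := by
  have htilt : ∀ j : Fin K, ∃ s : ℝ, 1 ≤ s ∧ (j ≠ Y →
      ∑ k, π k * ((if k = j then s else 1) * (if k = Y then s⁻¹ else 1)) < 1) := by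
    intro j
    by_cases hj : j = Y
    · exact ⟨1, le_rfl, fun h => absurd hj h⟩
    · obtain ⟨s, hs, hlt⟩ := exists_tilt_sum_lt_one hπ0 hπ1 hj (hmode j hj)
      exact ⟨s, hs, fun _ => hlt⟩
  choose s hs1 hs using htilt
  have hfac0 : ∀ j k : Fin K,
      0 ≤ π k * ((if k = j then s j else 1) * (if k = Y then (s j)⁻¹ else 1)) := by
    intro j k
    have := hs1 j
    have := hπ0 k
    split_ifs <;> positivity
  have htotal : ∀ U : ℕ, ∑ x : Fin U → Fin K, ∏ u, π (x u) = 1 := by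
    intro U
    rw [← Fintype.sum_pow, hπ1, one_pow]
  have hlim : Filter.Tendsto (fun U : ℕ => 1 - ∑ j ∈ Finset.univ.erase Y,
      (∑ k, π k * ((if k = j then s j else 1) * (if k = Y then (s j)⁻¹ else 1))) ^ U)
      Filter.atTop (nhds 1) := by
    have hsum := tendsto_finsetSum (Finset.univ.erase Y) fun j hj =>
      tendsto_pow_atTop_nhds_zero_of_lt_one (Finset.sum_nonneg fun k _ => hfac0 j k)
        (hs j (Finset.ne_of_mem_erase hj))
    simpa using hsum.const_sub 1
  refine tendsto_of_tendsto_of_tendsto_of_le_of_le hlim tendsto_const_nhds ?_ ?_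
  · intro U
    simp only [Fintype.sum_pow]
    rw [Finset.sum_comm]
    refine (sub_left_inj.2 (htotal U).symm).trans_le ?_
    rw [← Finset.sum_sub_distrib]
    refine Finset.sum_le_sum fun x _ => ?_
    have hnn : ∀ j ∈ Finset.univ.erase Y, 0 ≤ ∏ u, (π (x u) *
        ((if x u = j then s j else 1) * (if x u = Y then (s j)⁻¹ else 1))) :=
      fun j _ => Finset.prod_nonneg fun u _ => hfac0 j (x u)
    split_ifs with hwin
    · linarith [Finset.sum_nonneg hnn]
    · push Not at hwin
      obtain ⟨j, hj, hle⟩ := hwin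
      have hsingle := Finset.single_le_sum hnn (Finset.mem_erase.2 ⟨hj, Finset.mem_univ j⟩)
      rw [Finset.prod_mul_distrib] at hsingle
      have hone := le_mul_of_one_le_right
        (Finset.prod_nonneg fun u (_ : u ∈ Finset.univ) => hπ0 (x u))
        (one_le_prod_tilt x j Y (hs1 j) hle)
      linarith
  · intro U
    rw [← htotal U]
    refine Finset.sum_le_sum fun x _ => ?_
    have := Finset.prod_nonneg fun u (_ : u ∈ Finset.univ) => hπ0 (x u)
    split_ifs
    · exact le_rfl
    · exact this
end
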